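/- arXiv:2006.04268 — 2 statements merged into one kernel-verified Lean document; each statement's English description precedes it below -/
import Mathlib

section
/- A king permutation σ ∈ K_n is k-prolific in K_n (every (n−k)-subset of its entries forms a unique pattern, and all such patterns lie in K_{n−k}) if and only if br(σ) ≥ k + 3. -/
open Finset

/-- Manhattan distance between the plot points `i` and `j` of `σ`. -/
def mdist {n : ℕ} (σ : Fin n → Fin n) (i j : Fin n) : ℕ :=
  Nat.dist (i : ℕ) (j : ℕ) + Nat.dist (σ i : ℕ) (σ j : ℕ)

/-- The breadth of `σ`: minimum Manhattan distance over distinct pairs (⊤ if no pairs). -/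
noncomputable def br {n : ℕ} (σ : Fin n → Fin n) : ℕ∞ :=
  sInf {x : ℕ∞ | ∃ i j : Fin n, i ≠ j ∧ x = (mdist σ i j : ℕ∞)}

/-- Cyclic Manhattan distance: `|σ j - σ i| + min (|j-i|) (n - |j-i|)`. -/
def cdist {n : ℕ} (σ : Fin n → Fin n) (i j : Fin n) : ℕ :=
  Nat.dist (σ i : ℕ) (σ j : ℕ) +
    min (Nat.dist (i : ℕ) (j : ℕ)) (n - Nat.dist (i : ℕ) (j : ℕ))

/-- Cyclic breadth of `σ`. -/
noncomputable def cbr {n : ℕ} (σ : Fin n → Fin n) : ℕ∞ :=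
  sInf {x : ℕ∞ | ∃ i j : Fin n, i ≠ j ∧ x = (cdist σ i j : ℕ∞)}

/-- King permutation: consecutive entries differ by more than 1. -/
def IsKing {n : ℕ} (σ : Fin n → Fin n) : Prop :=
  ∀ i j : Fin n, (j : ℕ) = (i : ℕ) + 1 → 1 < Nat.dist (σ i : ℕ) (σ j : ℕ)

/-- Cylindrical king permutation: cyclically consecutive entries differ by more than 1. -/
def IsCylKing {n : ℕ} (σ : Fin n → Fin n) : Prop :=
  ∀ i j : Fin n, i ≠ j → (j : ℕ) = ((i : ℕ) + 1) % n →
    1 < Nat.dist (σ i : ℕ) (σ j : ℕ)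

/-- `π` is the (standardized) pattern formed by the entries of `σ` at the index set `s`. -/
def IsPatternOn {n m : ℕ} (σ : Fin n → Fin n) (s : Finset (Fin n))
    (π : Fin m → Fin m) : Prop :=
  ∃ f : Fin m → Fin n, StrictMono f ∧ (∀ a, f a ∈ s) ∧ s.card = m ∧
    ∀ a b, (π a < π b ↔ σ (f a) < σ (f b))

/-- `σ` contains the pattern `π` (classical pattern containment). -/
def ContainsPat {n m : ℕ} (σ : Fin n → Fin n) (π : Fin m → Fin m) : Prop :=
  ∃ f : Fin m → Fin n, StrictMono f ∧ ∀ a b, (π a < π b ↔ σ (f a) < σ (f b))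

/-- `σ` is `k`-prolific in `K_n`: every `(n-k)`-subset of its entries forms a king
pattern, and distinct subsets form distinct patterns. -/
def KProlificKing {n : ℕ} (σ : Fin n → Fin n) (k : ℕ) : Prop :=
  (∀ (s : Finset (Fin n)) (π : Fin (n - k) → Fin (n - k)),
      s.card = n - k → IsPatternOn σ s π → IsKing π) ∧
  ∀ (s t : Finset (Fin n)) (π : Fin (n - k) → Fin (n - k)),
      s.card = n - k → t.card = n - k →
      IsPatternOn σ s π → IsPatternOn σ t π → s = t

/-- `w` lies strictly between `p` and `q` with respect to the coordinate `z`. -/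
def StrictBtw {P : Type*} (z : P → ℤ) (p q w : P) : Prop :=
  (z p < z w ∧ z w < z q) ∨ (z q < z w ∧ z w < z p)

open Classical in
/-- The points lying strictly between `p` and `q` in at least one of two coordinates. -/
noncomputable def crossSet {P : Type*} [Fintype P] (x y : P → ℤ) (p q : P) : Finset P :=
  univ.filter fun w => StrictBtw x p q w ∨ StrictBtw y p q w

lemma mem_crossSet {P : Type*} [Fintype P] {x y : P → ℤ} {p q w : P} :
    w ∈ crossSet x y p q ↔ StrictBtw x p q w ∨ StrictBtw y p q w := by
  simp [crossSet]

/-- The partial map sending `f a` to `g a`, as a relation. -/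
def Shift {ι P : Type*} (f g : ι → P) (p q : P) : Prop := ∃ a, f a = p ∧ g a = q

/-- `f` and `g` are ordered in the same way by the coordinate `z`. -/
def SameOrder {ι P : Type*} (z : P → ℤ) (f g : ι → P) : Prop :=
  ∀ a b, z (f a) < z (f b) ↔ z (g a) < z (g b)

/-- `f a` starts a maximal chain of shifts along which both coordinates increase. -/
def IsStart {ι P : Type*} (x y : P → ℤ) (f g : ι → P) (a : ι) : Prop :=
  f a ∉ Set.range g ∧ x (f a) < x (g a) ∧ y (f a) < y (g a)

section Shift

variable {ι P : Type*} {f g : ι → P} {x y z : P → ℤ}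

lemma Shift.reflTransGen_increasing_iff (hz : SameOrder z f g) (hf : Function.Injective f)
    {c d : ι} (h : Relation.ReflTransGen (Shift f g) (f c) (f d)) :
    z (f c) < z (g c) ↔ z (f d) < z (g d) := by
  generalize hw : f d = w at h
  induction h generalizing d with
  | refl => rw [hf hw]
  | tail _ hs ih =>
    obtain ⟨e, he, rfl⟩ := hs
    rw [ih he, ← he, ← hw, hz e d, hw]

lemma Shift.le_of_reflTransGen (hz : SameOrder z f g) (hf : Function.Injective f)
    {c : ι} (hc : z (f c) < z (g c)) {w : P}
    (h : Relation.ReflTransGen (Shift f g) (f c) w) : z (f c) ≤ z w := by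
  induction h with
  | refl => exact le_rfl
  | tail h hs ih =>
    obtain ⟨e, rfl, rfl⟩ := hs
    exact ih.trans ((reflTransGen_increasing_iff hz hf h).1 hc).le

lemma Shift.exists_root [Finite P] (hz : SameOrder z f g) (c : ι) (hc : z (f c) < z (g c)) :
    ∃ b, b ∉ Set.range g ∧ Relation.ReflTransGen (Shift f g) b (f c) := by
  have wf : WellFounded (fun p q : P => z p < z q) :=
    Finite.wellFounded_of_trans_of_irrefl _
  generalize hp : f c = p
  induction p using wf.induction generalizing c with
  | _ p ih =>
    by_cases h : p ∈ Set.range g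
    · obtain ⟨d, rfl⟩ := h
      have h1 : z (f d) < z (f c) := by rw [hz, ← hp]; exact hc
      rw [hp] at h1
      obtain ⟨b, hb, hr⟩ := ih _ h1 d h1 rfl
      exact ⟨b, hb, hr.tail ⟨d, rfl, rfl⟩⟩
    · exact ⟨p, h, .refl⟩

lemma Shift.exists_root_of_mem [Finite P] (hz : SameOrder z f g) {a : ι} {w : P}
    (h1 : z (f a) < z w) (h2 : z w < z (g a)) :
    ∃ b, b ∉ Set.range g ∧ Relation.ReflTransGen (Shift f g) b w := by
  by_cases h : w ∈ Set.range g
  · obtain ⟨c, rfl⟩ := h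
    have := (hz c a).2 h2
    obtain ⟨b, hb, hr⟩ := exists_root hz c (this.trans h1)
    exact ⟨b, hb, hr.tail ⟨c, rfl, rfl⟩⟩
  · exact ⟨w, h, .refl⟩

lemma Shift.eq_of_reflTransGen (hz : SameOrder z f g) (hf : Function.Injective f) {a : ι}
    {w w' : P} (h1 : z (f a) < z w) (h2' : z w' < z (g a))
    (h : Relation.ReflTransGen (Shift f g) w w') (h2 : z w < z (g a)) : w = w' := by
  rcases h.cases_tail with h | ⟨v, hv, d, rfl, rfl⟩
  · exact h.symm
  · exfalso
    have hd : z (f d) < z (f a) := (hz d a).2 h2'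
    obtain ⟨c, rfl⟩ : ∃ c, f c = w := by
      rcases hv.cases_head with h | ⟨_, ⟨c, hc, _⟩, _⟩
      exacts [⟨d, h.symm⟩, ⟨c, hc⟩]
    have hc : z (f c) < z (g c) := h2.trans ((hz a c).1 h1)
    have := le_of_reflTransGen hz hf hc hv
    omega

lemma Shift.rightUnique (hf : Function.Injective f) : Relator.RightUnique (Shift f g) := by
  rintro p q r ⟨a, rfl, rfl⟩ ⟨b, hb, rfl⟩
  rw [hf hb]

/-- If a chain contains distinct points `w`, `w'`, in this order, such that `w` is in the
`x`-window of `a` and `w'` in the `y`-window of `l`, then it increases in both coordinates. -/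
lemma Shift.exists_isStart (hx : SameOrder x f g) (hy : SameOrder y f g)
    (hf : Function.Injective f) {a l : ι} {w w' b : P}
    (h1 : x (f a) < x w) (h2 : x w < x (g a)) (h3 : y (f l) < y w') (h4 : y w' < y (g l))
    (hb : b ∉ Set.range g) (hbw : Relation.ReflTransGen (Shift f g) b w)
    (h : Relation.ReflTransGen (Shift f g) w w') (hne : w ≠ w') :
    ∃ e, IsStart x y f g e ∧ x (f e) ≤ x w ∧ y (f e) < y (f l) := by
  rcases h.cases_tail with h | ⟨v, hv, d, rfl, rfl⟩
  · exact absurd h.symm hne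
  have hd : y (f d) < y (f l) := (hy d l).2 h4
  obtain ⟨c, rfl⟩ : ∃ c, f c = w := by
    rcases hv.cases_head with h | ⟨_, ⟨c, hc, _⟩, _⟩
    exacts [⟨d, h.symm⟩, ⟨c, hc⟩]
  obtain ⟨e, rfl⟩ : ∃ e, f e = b := by
    rcases hbw.cases_head with h | ⟨_, ⟨c, hc, _⟩, _⟩
    exacts [⟨c, h.symm⟩, ⟨c, hc⟩]
  have hc : x (f c) < x (g c) := h2.trans ((hx a c).1 h1)
  have hex := (reflTransGen_increasing_iff hx hf hbw).2 hc
  have hey := (reflTransGen_increasing_iff hy hf (hbw.trans hv)).2 (hd.trans h3)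
  exact ⟨e, ⟨hb, hex, hey⟩, le_of_reflTransGen hx hf hex hbw,
    (le_of_reflTransGen hy hf hey (hbw.trans hv)).trans_lt hd⟩

lemma Shift.card_le_of_windows [Fintype P] (hx : SameOrder x f g) (hy : SameOrder y f g)
    (hf : Function.Injective f) {D : Finset P} (hD : ∀ w, w ∉ Set.range g ↔ w ∈ D)
    {a l : ι} (U : Finset P) (A B : P → Prop)
    (hU : ∀ w ∈ U, A w ∨ B w)
    (hA : ∀ w, A w → x (f a) < x w ∧ x w < x (g a))
    (hB : ∀ w, B w → y (f l) < y w ∧ y w < y (g l))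
    (hX : ∀ e, IsStart x y f g e → ∀ w, A w → x (f e) ≤ x w → ¬ y (f e) < y (f l))
    (hY : ∀ e, IsStart x y f g e → ∀ w, B w → y (f e) ≤ y w → ¬ x (f e) < x (f a)) :
    U.card ≤ D.card := by
  refine Finset.card_le_card_of_forall_subsingleton
    (fun w b => Relation.ReflTransGen (Shift f g) b w) ?_ ?_
  · intro w hw
    have : ∃ b, b ∉ Set.range g ∧ Relation.ReflTransGen (Shift f g) b w := by
      rcases hU w hw with h | h
      · exact exists_root_of_mem hx (hA w h).1 (hA w h).2
      · exact exists_root_of_mem hy (hB w h).1 (hB w h).2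
    simpa only [hD] using this
  · intro b hb
    rw [← hD] at hb
    have key : ∀ w w', w ∈ U → w' ∈ U → Relation.ReflTransGen (Shift f g) b w →
        Relation.ReflTransGen (Shift f g) w w' → w = w' := by
      intro w w' hw hw' hbw h
      by_contra hne
      rcases hU w hw with h1 | h1 <;> rcases hU w' hw' with h2 | h2
      · exact hne (eq_of_reflTransGen hx hf (hA w h1).1 (hA w' h2).2 h (hA w h1).2)
      · obtain ⟨e, he, h3, h4⟩ := exists_isStart hx hy hf (hA w h1).1 (hA w h1).2
          (hB w' h2).1 (hB w' h2).2 hb hbw h hne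
        exact hX e he w h1 h3 h4
      · obtain ⟨e, he, h3, h4⟩ := exists_isStart hy hx hf (hB w h1).1 (hB w h1).2
          (hA w' h2).1 (hA w' h2).2 hb hbw h hne
        exact hY e ⟨he.1, he.2.2, he.2.1⟩ w h1 h3 h4
      · exact hne (eq_of_reflTransGen hy hf (hB w h1).1 (hB w' h2).2 h (hB w h1).2)
    rintro w ⟨hw, hbw⟩ w' ⟨hw', hbw'⟩
    rcases Relation.ReflTransGen.total_of_right_unique (rightUnique hf) hbw hbw' with h | h
    · exact key w w' hw hw' hbw h
    · exact (key w' w hw' hw hbw' h).symm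

lemma Shift.exists_isStart_of_increasing [Finite P] (hx : SameOrder x f g)
    (hy : SameOrder y f g) (hf : Function.Injective f) {a : ι}
    (ha : x (f a) < x (g a)) (ha' : y (f a) < y (g a)) : ∃ e, IsStart x y f g e := by
  obtain ⟨b, hb, h⟩ := exists_root hx a ha
  obtain ⟨e, rfl⟩ : ∃ e, f e = b := by
    rcases h.cases_head with h | ⟨_, ⟨c, hc, _⟩, _⟩
    exacts [⟨a, h.symm⟩, ⟨c, hc⟩]
  exact ⟨e, hb, (reflTransGen_increasing_iff hx hf h).2 ha,
    (reflTransGen_increasing_iff hy hf h).2 ha'⟩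

/-- If two embeddings with the same `x`- and `y`-order differ by an increase in both coordinates
somewhere, then some two points have few points between them. -/
lemma Shift.exists_card_crossSet_le_of_increasing [Fintype P] [Finite ι]
    (hxi : Function.Injective x) (hyi : Function.Injective y)
    (hx : SameOrder x f g) (hy : SameOrder y f g) (hf : Function.Injective f)
    {D : Finset P} (hD : ∀ w, w ∉ Set.range g ↔ w ∈ D) {a : ι}
    (ha : x (f a) < x (g a)) (ha' : y (f a) < y (g a)) :
    ∃ p q, p ≠ q ∧
      (crossSet x y p q).card ≤ D.card := by
  by_contra! hcon
  obtain ⟨e₀, he₀⟩ := exists_isStart_of_increasing hx hy hf ha ha'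
  let Minimal : ι → Prop := fun e => IsStart x y f g e ∧
    ∀ e', IsStart x y f g e' → x (f e') < x (f e) → ¬ y (f e') < y (f e)
  let DownBad : ι → Prop := fun e => ∃ e', IsStart x y f g e' ∧ x (f e) < x (f e') ∧
    x (f e') < x (g e) ∧ y (f e') < y (f e)
  let UpBad : ι → Prop := fun e => ∃ e', IsStart x y f g e' ∧ y (f e) < y (f e') ∧
    y (f e') < y (g e) ∧ x (f e') < x (f e)
  have hbad : ∀ e, Minimal e → DownBad e ∨ UpBad e := by
    rintro e ⟨hs, hmin⟩
    by_contra! hnb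
    obtain ⟨hd, hu⟩ := hnb
    refine (hcon (f e) (g e) fun h => hs.2.1.ne (congrArg x h)).not_ge ?_
    have h1 := hs.2.1
    have h2 := hs.2.2
    refine card_le_of_windows hx hy hf hD (a := e) (l := e) _
      (fun w => x (f e) < x w ∧ x w < x (g e)) (fun w => y (f e) < y w ∧ y w < y (g e))
      ?_ (fun _ h => h) (fun _ h => h) ?_ ?_
    · intro w hw
      simp only [mem_crossSet, StrictBtw] at hw
      omega
    · rintro e' he' w ⟨_, h4⟩ h5 h6
      rcases lt_trichotomy (x (f e')) (x (f e)) with h | h | h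
      · exact hmin e' he' h h6
      · rw [hxi h] at h6; exact lt_irrefl _ h6
      · exact hd ⟨e', he', h, h5.trans_lt h4, h6⟩
    · rintro e' he' w ⟨_, h4⟩ h5 h6
      rcases lt_trichotomy (y (f e')) (y (f e)) with h | h | h
      · exact hmin e' he' h6 h
      · rw [hyi h] at h6; exact lt_irrefl _ h6
      · exact hu ⟨e', he', h, h5.trans_lt h4, h6⟩
  have hexists : ∃ e, Minimal e ∧ DownBad e := by
    obtain ⟨e, he, hle⟩ := Set.exists_min_image {e | IsStart x y f g e} (fun e => x (f e))
      (Set.toFinite _) ⟨e₀, he₀⟩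
    have hm : Minimal e := ⟨he, fun e' he' h => absurd (hle e' he') h.not_ge⟩
    refine ⟨e, hm, (hbad e hm).resolve_right ?_⟩
    rintro ⟨e', he', _, _, h⟩
    exact h.not_ge (hle e' he')
  obtain ⟨p, ⟨hpm, e₁, he₁, h1, h2, h3⟩, hpmax⟩ :=
    Set.exists_max_image {e | Minimal e ∧ DownBad e} (fun e => x (f e)) (Set.toFinite _) hexists
  obtain ⟨q, ⟨hqs, hqp⟩, hqmin⟩ := Set.exists_min_image
    {e | IsStart x y f g e ∧ y (f e) < y (f p)} (fun e => x (f e)) (Set.toFinite _)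
    ⟨e₁, he₁, h3⟩
  have hqm : Minimal q := ⟨hqs, fun e' he' h h' => h.not_ge (hqmin e' ⟨he', h'.trans hqp⟩)⟩
  have hpq : x (f p) < x (f q) := by
    rcases lt_trichotomy (x (f q)) (x (f p)) with h | h | h
    · exact absurd hqp (hpm.2 q hqs h)
    · rw [hxi h] at hqp; exact absurd hqp (lt_irrefl _)
    · exact h
  have hqx : x (f q) < x (g p) := (hqmin e₁ ⟨he₁, h3⟩).trans_lt h2
  have hqu : UpBad q := (hbad q hqm).resolve_left fun h => hpq.not_ge (hpmax q ⟨hqm, h⟩)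
  obtain ⟨e₂, he₂, h4, h5, h6⟩ := hqu
  have hpy : y (f p) < y (g q) := by
    by_contra! h
    exact h6.not_ge (hqmin e₂ ⟨he₂, h5.trans_le h⟩)
  refine (hcon (f p) (f q) fun h => hpq.ne (congrArg x h)).not_ge ?_
  refine card_le_of_windows hx hy hf hD (a := p) (l := q) _
    (fun w => x (f p) < x w ∧ x w < x (f q)) (fun w => y (f q) < y w ∧ y w < y (f p))
    ?_ (fun _ h => ⟨h.1, h.2.trans hqx⟩) (fun _ h => ⟨h.1, h.2.trans hpy⟩) ?_ ?_
  · intro w hw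
    simp only [mem_crossSet, StrictBtw] at hw
    omega
  · rintro e he w ⟨_, h⟩ h7 h8
    exact hqm.2 e he (h7.trans_lt h) h8
  · rintro e he w ⟨_, h⟩ h7 h8
    exact hpm.2 e he h8 (h7.trans_lt h)

/-- If two distinct embeddings have the same `x`- and `y`-order, then some two points have few
points between them. -/
lemma Shift.exists_card_crossSet_le [Fintype P] [Finite ι]
    (hxi : Function.Injective x) (hyi : Function.Injective y)
    (hx : SameOrder x f g) (hy : SameOrder y f g) (hf : Function.Injective f)
    {D : Finset P} (hD : ∀ w, w ∉ Set.range g ↔ w ∈ D) {a : ι}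
    (ha : f a ≠ g a) :
    ∃ p q, p ≠ q ∧
      (crossSet x y p q).card ≤ D.card := by
  have hneg : ∀ {z : P → ℤ}, SameOrder z f g → SameOrder (fun p => -z p) f g := by
    intro z hz a b
    simpa using hz b a
  have hinj : ∀ {z : P → ℤ}, Function.Injective z → Function.Injective fun p => -z p :=
    fun hz _ _ h => hz (neg_injective h)
  have hcx : ∀ (x y : P → ℤ) p q, crossSet (fun p => -x p) y p q = crossSet x y p q := by
    intro x y p q
    ext w
    simp only [mem_crossSet, StrictBtw]
    omega
  have hcy : ∀ (x y : P → ℤ) p q, crossSet x (fun p => -y p) p q = crossSet x y p q := by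
    intro x y p q
    ext w
    simp only [mem_crossSet, StrictBtw]
    omega
  rcases lt_or_gt_of_ne (hxi.ne ha) with h1 | h1 <;>
    rcases lt_or_gt_of_ne (hyi.ne ha) with h2 | h2
  · exact exists_card_crossSet_le_of_increasing hxi hyi hx hy hf hD h1 h2
  · simpa only [hcx, hcy] using
      exists_card_crossSet_le_of_increasing hxi (hinj hyi) hx (hneg hy) hf hD h1 (neg_lt_neg h2)
  · simpa only [hcx, hcy] using
      exists_card_crossSet_le_of_increasing (hinj hxi) hyi (hneg hx) hy hf hD (neg_lt_neg h1) h2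
  · simpa only [hcx, hcy] using exists_card_crossSet_le_of_increasing (hinj hxi) (hinj hyi)
      (hneg hx) (hneg hy) hf hD (neg_lt_neg h1) (neg_lt_neg h2)

end Shift

section Plot

variable {n : ℕ}

/-- Horizontal coordinate of a plot point. -/
def xCoord (i : Fin n) : ℤ := (i : ℕ)

/-- Vertical coordinate of a plot point. -/
def yCoord (σ : Fin n → Fin n) (i : Fin n) : ℤ := (σ i : ℕ)

lemma xCoord_injective : Function.Injective (xCoord (n := n)) := by
  intro i j h
  simp only [xCoord] at h
  omega

lemma yCoord_injective (σ : Equiv.Perm (Fin n)) : Function.Injective (yCoord σ) := by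
  intro i j h
  simp only [yCoord] at h
  exact σ.injective (by omega)

open Classical in
lemma card_strictBtw_yCoord_add_one (σ : Equiv.Perm (Fin n)) {p q : Fin n} (hpq : p ≠ q) :
    (univ.filter fun w => StrictBtw (yCoord σ) p q w).card + 1 =
      Nat.dist (σ p : ℕ) (σ q : ℕ) := by
  have hne : (σ p : ℕ) ≠ σ q := fun h => hpq (σ.injective (Fin.ext h))
  have : (univ.filter fun w => StrictBtw (yCoord σ) p q w).map σ.toEmbedding =
      Ioo (min (σ p) (σ q)) (max (σ p) (σ q)) := by
    ext w
    obtain ⟨w, rfl⟩ := σ.surjective w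
    simp [StrictBtw, yCoord]
    omega
  rw [← card_map σ.toEmbedding, this, Fin.card_Ioo]
  simp only [Nat.dist, Fin.coe_min, Fin.coe_max]
  omega

open Classical in
lemma card_strictBtw_xCoord_add_one {p q : Fin n} (hpq : p ≠ q) :
    (univ.filter fun w => StrictBtw xCoord p q w).card + 1 = Nat.dist (p : ℕ) (q : ℕ) :=
  card_strictBtw_yCoord_add_one (Equiv.refl _) hpq

lemma card_crossSet_add_two_le (σ : Equiv.Perm (Fin n)) {p q : Fin n} (hpq : p ≠ q) :
    (crossSet xCoord (yCoord σ) p q).card + 2 ≤ mdist σ p q := by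
  classical
  have h1 := card_strictBtw_xCoord_add_one hpq
  have h2 := card_strictBtw_yCoord_add_one σ hpq
  have h3 := card_union_le (univ.filter fun w => StrictBtw xCoord p q w)
    (univ.filter fun w => StrictBtw (yCoord σ) p q w)
  rw [← filter_or] at h3
  rw [mdist, ← h1, ← h2]
  unfold crossSet
  omega

lemma le_br_iff (σ : Fin n → Fin n) (d : ℕ) :
    (d : ℕ∞) ≤ br σ ↔ ∀ i j, i ≠ j → d ≤ mdist σ i j := by
  rw [br, le_sInf_iff]
  constructor
  · intro h i j hij
    exact_mod_cast h _ ⟨i, j, hij, rfl⟩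
  · rintro h _ ⟨i, j, hij, rfl⟩
    exact_mod_cast h i j hij

lemma le_card_crossSet (σ : Equiv.Perm (Fin n)) {d : ℕ}
    (h : ∀ i j, i ≠ j → d + 2 ≤ mdist σ i j) {p q : Fin n} (hpq : p ≠ q) :
    d ≤ (crossSet xCoord (yCoord σ) p q).card := by
  classical
  generalize hm : mdist σ p q = m
  induction m using Nat.strong_induction_on generalizing q with
  | _ m ih =>
    by_cases hw : ∃ w, StrictBtw xCoord p q w ∧ StrictBtw (yCoord σ) p q w
    · obtain ⟨w, hx, hy⟩ := hw
      simp only [StrictBtw, xCoord, yCoord] at hx hy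
      have hlt : mdist σ p w < m := by
        rw [← hm]
        simp only [mdist, Nat.dist]
        omega
      refine (ih _ hlt (by rintro rfl; omega) rfl).trans (card_le_card fun v hv => ?_)
      simp only [mem_crossSet, StrictBtw, xCoord, yCoord] at hv ⊢
      omega
    · have h1 := card_strictBtw_xCoord_add_one hpq
      have h2 := card_strictBtw_yCoord_add_one σ hpq
      have h3 := h p q hpq
      have hdisj : Disjoint (univ.filter fun w => StrictBtw xCoord p q w)
          (univ.filter fun w => StrictBtw (yCoord σ) p q w) := by
        rw [disjoint_filter]
        exact fun w _ hx hy => hw ⟨w, hx, hy⟩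
      have h4 := card_union_of_disjoint hdisj
      rw [← filter_or] at h4
      rw [mdist, ← h1, ← h2] at h3
      unfold crossSet
      omega

lemma exists_isPatternOn (σ : Equiv.Perm (Fin n)) {m : ℕ} (s : Finset (Fin n))
    (hs : s.card = m) : ∃ π : Equiv.Perm (Fin m), IsPatternOn σ s π := by
  let f := s.orderEmbOfFin hs
  have hc : (s.map σ.toEmbedding).card = m := by rw [card_map, hs]
  let e := (s.map σ.toEmbedding).orderIsoOfFin hc
  have hmem : ∀ a, σ (f a) ∈ s.map σ.toEmbedding := fun a =>
    mem_map_of_mem σ.toEmbedding (s.orderEmbOfFin_mem hs a)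
  let π : Fin m → Fin m := fun a => e.symm ⟨σ (f a), hmem a⟩
  have hπ : Function.Injective π := by
    intro a b h
    have := e.symm.injective h
    exact f.injective (σ.injective (congrArg Subtype.val this))
  refine ⟨Equiv.ofBijective π (Finite.injective_iff_bijective.1 hπ), f, f.strictMono,
    s.orderEmbOfFin_mem hs, hs, fun a b => ?_⟩
  simp only [Equiv.ofBijective_apply, π]
  rw [e.symm.lt_iff_lt, Subtype.mk_lt_mk]

lemma range_eq_of_card {m : ℕ} {f : Fin m → Fin n} {s : Finset (Fin n)} (hf : StrictMono f)
    (hmem : ∀ a, f a ∈ s) (hs : s.card = m) : Set.range f = s := by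
  have : univ.map ⟨f, hf.injective⟩ = s := by
    refine eq_of_subset_of_card_le (fun w hw => ?_) (by simp [hs])
    obtain ⟨a, -, rfl⟩ := mem_map.1 hw
    exact hmem a
  rw [← this]
  simp

lemma isKing_of_isPatternOn (σ : Equiv.Perm (Fin n)) {m : ℕ}
    (hσ : ∀ p q, p ≠ q → n - m < (crossSet xCoord (yCoord σ) p q).card)
    {s : Finset (Fin n)} {π : Fin m → Fin m} (h : IsPatternOn σ s π) : IsKing π := by
  obtain ⟨f, hf, hmem, hs, hπ⟩ := h
  intro i j hij
  by_contra! hle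
  have hne : f i ≠ f j := fun h => by
    have := hf.injective h
    omega
  have hr := range_eq_of_card hf hmem hs
  have hsub : crossSet xCoord (yCoord σ) (f i) (f j) ⊆ sᶜ := by
    intro w hw
    rw [mem_compl]
    intro hws
    obtain ⟨c, rfl⟩ : w ∈ Set.range f := hr ▸ hws
    have e1 := hf.lt_iff_lt (a := i) (b := c)
    have e2 := hf.lt_iff_lt (a := c) (b := j)
    have e3 := hf.lt_iff_lt (a := j) (b := c)
    have e4 := hf.lt_iff_lt (a := c) (b := i)
    have e5 := hπ i c
    have e6 := hπ c j
    have e7 := hπ j c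
    have e8 := hπ c i
    simp only [mem_crossSet, StrictBtw, xCoord, yCoord, Nat.dist] at hw hle
    omega
  have h1 := card_le_card hsub
  rw [card_compl, Fintype.card_fin, hs] at h1
  exact (hσ _ _ hne).not_ge h1

lemma eq_of_isPatternOn (σ : Equiv.Perm (Fin n)) {m : ℕ}
    (hσ : ∀ p q, p ≠ q → n - m < (crossSet xCoord (yCoord σ) p q).card)
    {s t : Finset (Fin n)} {π : Fin m → Fin m} (h : IsPatternOn σ s π)
    (h' : IsPatternOn σ t π) : s = t := by
  obtain ⟨f, hf, hfm, hs, hfπ⟩ := h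
  obtain ⟨g, hg, hgm, ht, hgπ⟩ := h'
  have hrf := range_eq_of_card hf hfm hs
  have hrg := range_eq_of_card hg hgm ht
  by_contra hne
  have hfg : ∃ a, f a ≠ g a := by
    by_contra! h
    exact hne (coe_injective (by rw [← hrf, ← hrg, funext h]))
  obtain ⟨a, ha⟩ := hfg
  have hx : SameOrder xCoord f g := by
    intro b c
    simpa [xCoord] using hf.lt_iff_lt.trans hg.lt_iff_lt.symm
  have hy : SameOrder (yCoord σ) f g := by
    intro b c
    simpa [yCoord] using (hfπ b c).symm.trans (hgπ b c)
  obtain ⟨p, q, hpq, hle⟩ := Shift.exists_card_crossSet_le xCoord_injective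
    (yCoord_injective σ) hx hy hf.injective (D := tᶜ) (by simp [hrg]) ha
  rw [card_compl, Fintype.card_fin, ht] at hle
  exact (hσ p q hpq).not_ge hle

lemma exists_not_isKing (σ : Equiv.Perm (Fin n)) {m : ℕ} (hm : 2 ≤ m) (hmn : m ≤ n)
    {p q : Fin n} (hpq : p < q) (h : (crossSet xCoord (yCoord σ) p q).card ≤ n - m) :
    ∃ (s : Finset (Fin n)) (π : Fin m → Fin m), s.card = m ∧ IsPatternOn σ s π ∧ ¬ IsKing π := by
  obtain ⟨s, hps, hsc, hs⟩ : ∃ s, {p, q} ⊆ s ∧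
      s ⊆ (crossSet xCoord (yCoord σ) p q)ᶜ ∧ s.card = m := by
    refine exists_subsuperset_card_eq ?_ ?_ ?_
    · intro w hw
      rw [mem_compl]
      intro hw'
      simp only [mem_insert, mem_singleton] at hw
      simp only [mem_crossSet, StrictBtw, xCoord, yCoord] at hw'
      rcases hw with rfl | rfl <;> omega
    · rwa [card_pair hpq.ne]
    · rw [card_compl, Fintype.card_fin]
      omega
  obtain ⟨π, hπ⟩ := exists_isPatternOn σ s hs
  refine ⟨s, π, hs, hπ, fun hking => ?_⟩
  obtain ⟨f, hf, hmem, -, hπ⟩ := hπ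
  have hr := range_eq_of_card hf hmem hs
  obtain ⟨a, rfl⟩ : p ∈ Set.range f := hr ▸ hps (by simp)
  obtain ⟨b, rfl⟩ : q ∈ Set.range f := hr ▸ hps (by simp)
  have hnot : ∀ c, ¬ StrictBtw xCoord (f a) (f b) (f c) ∧
      ¬ StrictBtw (yCoord σ) (f a) (f b) (f c) := by
    intro c
    have := hsc (hmem c)
    rwa [mem_compl, mem_crossSet, not_or] at this
  have hab : a < b := hf.lt_iff_lt.1 hpq
  have hsucc : (b : ℕ) = a + 1 := by
    by_contra hne
    let c : Fin m := ⟨a + 1, by omega⟩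
    have h1 : f a < f c := hf (by simp [c, Fin.lt_def])
    have h2 : f c < f b := hf (by simp only [c, Fin.lt_def]; omega)
    have := (hnot c).1
    simp only [StrictBtw, xCoord] at this
    omega
  have hdist := hking a b hsucc
  have hval : ∀ v : Fin m, ¬ (π a < v ∧ v < π b) ∧ ¬ (π b < v ∧ v < π a) := by
    intro v
    obtain ⟨c, rfl⟩ := π.surjective v
    have := (hnot c).2
    simp only [StrictBtw, yCoord] at this
    rw [hπ, hπ, hπ, hπ]
    omega
  rcases Nat.lt_or_ge (π a) (π b) with hlt | hlt
  · have := hval ⟨π a + 1, by omega⟩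
    simp only [Fin.lt_def, Nat.dist] at this hdist
    omega
  · simp only [Nat.dist] at hdist
    have := hval ⟨π b + 1, by omega⟩
    simp only [Fin.lt_def] at this
    omega

end Plot

theorem stmt_8 (n k : ℕ) (hk : 1 ≤ k) (hkn : k ≤ n - 1)
    (σ : Equiv.Perm (Fin n)) (hσ : IsKing ⇑σ) :
    KProlificKing ⇑σ k ↔ (k + 3 : ℕ∞) ≤ br ⇑σ := by
  have hcast : (k + 3 : ℕ∞) = ((k + 3 : ℕ) : ℕ∞) := by push_cast; rfl
  rw [hcast, le_br_iff]
  constructor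
  · rintro ⟨hking, hinj⟩
    have key : ∀ i j : Fin n, i < j → k + 3 ≤ mdist σ i j := by
      intro i j hij
      by_contra! hlt
      have hcard := card_crossSet_add_two_le σ hij.ne
      rcases Nat.lt_or_ge (n - k) 2 with h | h
      · have h1 : n - k = 1 := by omega
        have hsub : Subsingleton (Fin (n - k)) := by rw [h1]; infer_instance
        have hpat : ∀ p : Fin n, IsPatternOn σ {p} (id : Fin (n - k) → Fin (n - k)) := by
          intro p
          refine ⟨fun _ => p, fun a b hab => absurd (Subsingleton.elim a b) hab.ne,
            fun _ => mem_singleton_self p, by simp [h1], fun a b => ?_⟩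
          simp [Subsingleton.elim a b]
        have := hinj {i} {j} id (by simp [h1]) (by simp [h1]) (hpat i) (hpat j)
        exact hij.ne (singleton_injective this)
      · obtain ⟨s, π, hs, hπ, hnk⟩ :=
          exists_not_isKing σ h (Nat.sub_le n k) hij (by omega)
        exact hnk (hking s π hs hπ)
    intro i j hij
    rcases lt_or_gt_of_ne hij with h | h
    · exact key i j h
    · have := key j i h
      rwa [mdist, Nat.dist_comm, Nat.dist_comm (σ j : ℕ)] at this
  · intro h
    have hcross : ∀ p q, p ≠ q → n - (n - k) < (crossSet xCoord (yCoord σ) p q).card := by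
      intro p q hpq
      have := le_card_crossSet σ (d := k + 1) h hpq
      omega
    exact ⟨fun s π _ hπ => isKing_of_isPatternOn σ hcross hπ,
      fun s t π _ _ hs ht => eq_of_isPatternOn σ hcross hs ht⟩
end

section
/- Let σ, π be cylindrical king permutations with π ≺ σ and |σ| − |π| > 4. Then there exists a cylindrical king permutation τ with π ≺ τ ≺ σ and |σ| − |τ| ≤ 4. That is, the maximal gap between comparable elements in the poset of cylindrical king permutations is 4. -/
open Finset

/-- `z` lies strictly between `x` and `y` in the linear order given by `f`, for some `z ∈ T`. -/
def LinSep {α : Type*} (f : α → ℤ) (T : Finset α) (x y : α) : Prop :=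
  ∃ z ∈ T, (f x < f z ∧ f z < f y) ∨ (f y < f z ∧ f z < f x)

/-- The strict cyclic order on `ℤ`. -/
def Cyc (a b c : ℤ) : Prop :=
  (a < b ∧ b < c) ∨ (b < c ∧ c < a) ∨ (c < a ∧ a < b)

/-- Both open cyclic arcs between `x` and `y` meet `T`. -/
def CycSep {α : Type*} (f : α → ℤ) (T : Finset α) (x y : α) : Prop :=
  (∃ z ∈ T, Cyc (f x) (f z) (f y)) ∧ ∃ z ∈ T, Cyc (f y) (f z) (f x)

/-- No two points of `T` are adjacent in both linear orders. -/
def LinFree {α : Type*} (g h : α → ℤ) (T : Finset α) : Prop :=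
  ∀ x ∈ T, ∀ y ∈ T, x ≠ y → LinSep g T x y ∨ LinSep h T x y

/-- No two points of `T` are adjacent both in the cyclic order of `g` and the linear order
of `h`. -/
def CylFree {α : Type*} (g h : α → ℤ) (T : Finset α) : Prop :=
  ∀ x ∈ T, ∀ y ∈ T, x ≠ y → CycSep g T x y ∨ LinSep h T x y

/-- `a, b, c, d` form an occurrence of `3142` or `2413`. -/
def IsSimpleQuad {α : Type*} (g h : α → ℤ) (a b c d : α) : Prop :=
  g a < g b ∧ g b < g c ∧ g c < g d ∧
    ((h b < h d ∧ h d < h a ∧ h a < h c) ∨ (h c < h a ∧ h a < h d ∧ h d < h b))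

/-- `P` splits off from `S` as the lower left summand. -/
def IsSummand {α : Type*} (g h : α → ℤ) (S P : Finset α) : Prop :=
  P ⊆ S ∧ P.Nonempty ∧ (∃ y ∈ S, y ∉ P) ∧ ∀ x ∈ P, ∀ y ∈ S, y ∉ P → g x < g y ∧ h x < h y

section Separable

variable {α : Type*} {g h : α → ℤ}

theorem LinSep.symm {f : α → ℤ} {T : Finset α} {x y : α} (H : LinSep f T x y) : LinSep f T y x := by
  obtain ⟨z, hz, H⟩ := H
  exact ⟨z, hz, H.symm⟩

theorem LinSep.mono {f : α → ℤ} {s T : Finset α} {x y : α} (hsT : s ⊆ T)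
    (H : LinSep f s x y) : LinSep f T x y := by
  obtain ⟨z, hz, H⟩ := H
  exact ⟨z, hsT hz, H⟩

theorem IsSimpleQuad.of_neg {a b c d : α} (H : IsSimpleQuad g (fun x => -h x) a b c d) :
    IsSimpleQuad g h a b c d := by
  simp only [IsSimpleQuad] at *
  omega

theorem IsSummand.extend [DecidableEq α] (hg : g.Injective) (hh : h.Injective)
    {S P : Finset α} {r : α} (hr : ∀ x ∈ S, g x < g r) (hP : IsSummand g h S P) :
    (∃ a ∈ S, ∃ b ∈ S, ∃ c ∈ S, IsSimpleQuad g h a b c r) ∨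
      (∃ P', IsSummand g h (insert r S) P') ∨
      ∃ P', IsSummand g (fun x => -h x) (insert r S) P' := by
  induction P using Finset.strongInduction with
  | H P ih =>
  obtain ⟨hPS, hPn, ⟨c, hcS, hcP⟩, hlt⟩ := hP
  have hrS : r ∉ S := fun hmem => lt_irrefl _ (hr r hmem)
  have hne : ∀ x ∈ S, h x ≠ h r := fun x hx hxr => hrS (hh hxr ▸ hx)
  by_cases habove : ∀ x ∈ P, h x < h r
  · refine Or.inr (Or.inl ⟨P, hPS.trans (Finset.subset_insert _ _), hPn,
      ⟨c, Finset.mem_insert_of_mem hcS, hcP⟩, fun x hx y hy hyP => ?_⟩)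
    rcases Finset.mem_insert.1 hy with rfl | hy
    · exact ⟨hr x (hPS hx), habove x hx⟩
    · exact hlt x hx y hy hyP
  push Not at habove
  obtain ⟨a₀, ha₀, ha₀r⟩ := habove
  by_cases hbelow : ∀ x ∈ S, h r < h x
  · refine Or.inr (Or.inr ⟨S, Finset.subset_insert _ _, ⟨c, hcS⟩,
      ⟨r, Finset.mem_insert_self _ _, hrS⟩, fun x hx y hy hyS => ?_⟩)
    rcases Finset.mem_insert.1 hy with rfl | hy
    · exact ⟨hr x hx, neg_lt_neg (hbelow x hx)⟩
    · exact absurd hy hyS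
  push Not at hbelow
  obtain ⟨b₀, hb₀, hb₀r⟩ := hbelow
  have hb₀r' : h b₀ < h r := lt_of_le_of_ne hb₀r (hne b₀ hb₀)
  have hb₀P : b₀ ∈ P := by
    by_contra hb
    have := (hlt a₀ ha₀ b₀ hb₀ hb).2
    omega
  by_cases hP' : IsSummand g h S (P.filter fun x => h x < h r)
  · exact ih _ (Finset.filter_ssubset.2 ⟨a₀, ha₀, by omega⟩) hP'
  have : ∃ b ∈ P.filter (fun x => h x < h r), ∃ a ∈ S, a ∉ P.filter (fun x => h x < h r) ∧
      ¬ (g b < g a ∧ h b < h a) := by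
    by_contra! hcon
    exact hP' ⟨(Finset.filter_subset _ _).trans hPS, ⟨b₀, by simp [hb₀P, hb₀r']⟩,
      ⟨c, hcS, by simp [hcP]⟩, fun x hx y hy hyP => hcon x hx y hy hyP⟩
  obtain ⟨b, hb, a, ha, haP', hab⟩ := this
  rw [Finset.mem_filter] at hb haP'
  have haP : a ∈ P := by
    by_contra haP
    exact hab (hlt b hb.1 a ha haP)
  have har : h r < h a :=
    lt_of_le_of_ne (not_lt.1 fun hlt' => haP' ⟨haP, hlt'⟩) (hne a ha).symm
  have hac := hlt a haP c hcS hcP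
  have hbc := hlt b hb.1 c hcS hcP
  have hrc := hr c hcS
  have hgab : g a ≠ g b := fun hgab => by
    have := hg hgab
    subst this
    omega
  exact Or.inl ⟨a, ha, b, hPS hb.1, c, hcS, by unfold IsSimpleQuad; omega⟩

/-- A set without `3142` and `2413` is sum- or skew-decomposable. -/
theorem exists_isSummand [DecidableEq α] (hg : g.Injective) (hh : h.Injective) (S : Finset α)
    (hS : 2 ≤ S.card)
    (hquad : ∀ a ∈ S, ∀ b ∈ S, ∀ c ∈ S, ∀ d ∈ S, ¬ IsSimpleQuad g h a b c d) :
    (∃ P, IsSummand g h S P) ∨ ∃ P, IsSummand g (fun x => -h x) S P := by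
  induction S using Finset.induction_on_max_value g with
  | empty => simp at hS
  | insert r S hrS hr ih =>
  have hr' : ∀ x ∈ S, g x < g r := fun x hx =>
    lt_of_le_of_ne (hr x hx) fun hxr => hrS (hg hxr ▸ hx)
  rw [Finset.card_insert_of_notMem hrS] at hS
  rcases (show S.card = 1 ∨ 2 ≤ S.card by omega) with hS1 | hS2
  · obtain ⟨x, rfl⟩ := Finset.card_eq_one.1 hS1
    have hxr : x ≠ r := fun hxr => hrS (by simp [hxr])
    have hgx := hr' x (by simp)
    rcases lt_or_gt_of_ne (fun hx => hxr (hh hx) : h x ≠ h r) with hlt | hlt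
    · refine Or.inl ⟨{x}, by simp, by simp, ⟨r, by simp, by simpa using hxr.symm⟩, ?_⟩
      simp [hgx, hlt]
    · refine Or.inr ⟨{x}, by simp, by simp, ⟨r, by simp, by simpa using hxr.symm⟩, ?_⟩
      simp [hgx, hlt]
  · have hsub : S ⊆ insert r S := Finset.subset_insert _ _
    have hmem : r ∈ insert r S := Finset.mem_insert_self _ _
    have hh' : (fun x => -h x).Injective := fun x y hxy => hh (neg_injective hxy)
    rcases ih hS2 fun a ha b hb c hc d hd =>
      hquad a (hsub ha) b (hsub hb) c (hsub hc) d (hsub hd) with ⟨P, hP⟩ | ⟨P, hP⟩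
    · rcases hP.extend hg hh hr' with ⟨a, ha, b, hb, c, hc, H⟩ | H
      · exact absurd H (hquad a (hsub ha) b (hsub hb) c (hsub hc) r hmem)
      · exact H
    · rcases hP.extend hg hh' hr' with ⟨a, ha, b, hb, c, hc, H⟩ | H
      · exact absurd H.of_neg (hquad a (hsub ha) b (hsub hb) c (hsub hc) r hmem)
      · simpa only [neg_neg, or_comm] using H

theorem LinSep.neg {T : Finset α} {x y : α} :
    LinSep (fun x => -h x) T x y ↔ LinSep h T x y := by
  unfold LinSep
  simp only [neg_lt_neg_iff]
  constructor <;> rintro ⟨z, hz, H⟩ <;> exact ⟨z, hz, by tauto⟩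

theorem LinFree.neg {T : Finset α} : LinFree g (fun x => -h x) T ↔ LinFree g h T := by
  unfold LinFree
  simp only [LinSep.neg]

theorem IsSummand.exists_linFree_ssubset [DecidableEq α] {S P : Finset α}
    (hP : IsSummand g h S P) (hS : LinFree g h S) :
    ∃ S' ⊂ S, 2 ≤ S'.card ∧ LinFree g h S' := by
  obtain ⟨hPS, ⟨x, hx⟩, ⟨y, hyS, hyP⟩, hlt⟩ := hP
  by_cases hP2 : 2 ≤ P.card
  · refine ⟨P, Finset.ssubset_iff_subset_ne.2 ⟨hPS, fun hPS' => hyP (hPS' ▸ hyS)⟩, hP2, ?_⟩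
    intro a ha b hb hab
    refine (hS a (hPS ha) b (hPS hb) hab).imp ?_ ?_ <;> rintro ⟨z, hz, H⟩ <;>
    · refine ⟨z, ?_, H⟩
      by_contra hzP
      have := hlt a ha z hz hzP
      have := hlt b hb z hz hzP
      omega
  by_cases hQ2 : 2 ≤ (S \ P).card
  · refine ⟨S \ P, Finset.ssubset_iff_subset_ne.2 ⟨Finset.sdiff_subset, fun hPS' => ?_⟩, hQ2, ?_⟩
    · have := hPS hx
      rw [← hPS'] at this
      exact (Finset.mem_sdiff.1 this).2 hx
    intro a ha b hb hab
    rw [Finset.mem_sdiff] at ha hb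
    refine (hS a ha.1 b hb.1 hab).imp ?_ ?_ <;> rintro ⟨z, hz, H⟩ <;>
    · refine ⟨z, Finset.mem_sdiff.2 ⟨hz, fun hzP => ?_⟩, H⟩
      have := hlt z hzP a ha.1 ha.2
      have := hlt z hzP b hb.1 hb.2
      omega
  · exfalso
    have hxy : x ≠ y := fun hxy => hyP (hxy ▸ hx)
    have huniq : ∀ z ∈ S, z = x ∨ z = y := by
      intro z hz
      by_cases hzP : z ∈ P
      · exact Or.inl (Finset.card_le_one.1 (by omega) z hzP x hx)
      · exact Or.inr (Finset.card_le_one.1 (by omega : (S \ P).card ≤ 1) z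
          (Finset.mem_sdiff.2 ⟨hz, hzP⟩) y (Finset.mem_sdiff.2 ⟨hyS, hyP⟩))
    rcases hS x (hPS hx) y hyS hxy with ⟨z, hz, H⟩ | ⟨z, hz, H⟩ <;>
      rcases huniq z hz with rfl | rfl <;> omega

/-- A set of at least two points without bonds contains `3142` or `2413`. -/
theorem LinFree.exists_isSimpleQuad [DecidableEq α] (hg : g.Injective) (hh : h.Injective)
    {S : Finset α} (hS : LinFree g h S) (hS2 : 2 ≤ S.card) :
    ∃ a ∈ S, ∃ b ∈ S, ∃ c ∈ S, ∃ d ∈ S, IsSimpleQuad g h a b c d := by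
  induction S using Finset.strongInduction with
  | H S ih =>
  by_contra! hcon
  have : ∃ S' ⊂ S, 2 ≤ S'.card ∧ LinFree g h S' := by
    rcases exists_isSummand hg hh S hS2 hcon with ⟨P, hP⟩ | ⟨P, hP⟩
    · exact hP.exists_linFree_ssubset hS
    · simpa only [LinFree.neg] using hP.exists_linFree_ssubset (LinFree.neg.2 hS)
  obtain ⟨S', hS', hS'2, hfree⟩ := this
  obtain ⟨a, ha, b, hb, c, hc, d, hd, H⟩ := ih S' hS' hfree hS'2
  exact hcon a (hS'.1 ha) b (hS'.1 hb) c (hS'.1 hc) d (hS'.1 hd) H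

theorem IsSimpleQuad.linFree [DecidableEq α] {a b c d : α} (H : IsSimpleQuad g h a b c d) :
    LinFree g h {a, b, c, d} := by
  obtain ⟨hab, hbc, hcd, H⟩ := H
  have symm : ∀ x y : α, LinSep g {a, b, c, d} x y ∨ LinSep h {a, b, c, d} x y →
      LinSep g {a, b, c, d} y x ∨ LinSep h {a, b, c, d} y x :=
    fun x y H => H.imp LinSep.symm LinSep.symm
  have h_ab : LinSep g {a, b, c, d} a b ∨ LinSep h {a, b, c, d} a b :=
    Or.inr ⟨d, by simp, by omega⟩
  have h_ac : LinSep g {a, b, c, d} a c ∨ LinSep h {a, b, c, d} a c :=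
    Or.inl ⟨b, by simp, by omega⟩
  have h_ad : LinSep g {a, b, c, d} a d ∨ LinSep h {a, b, c, d} a d :=
    Or.inl ⟨b, by simp, by omega⟩
  have h_bc : LinSep g {a, b, c, d} b c ∨ LinSep h {a, b, c, d} b c :=
    Or.inr ⟨a, by simp, by omega⟩
  have h_bd : LinSep g {a, b, c, d} b d ∨ LinSep h {a, b, c, d} b d :=
    Or.inl ⟨c, by simp, by omega⟩
  have h_cd : LinSep g {a, b, c, d} c d ∨ LinSep h {a, b, c, d} c d :=
    Or.inr ⟨a, by simp, by omega⟩
  intro x hx y hy hxy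
  simp only [Finset.mem_insert, Finset.mem_singleton] at hx hy
  rcases hx with rfl | rfl | rfl | rfl <;> rcases hy with rfl | rfl | rfl | rfl <;>
    first | exact absurd rfl hxy | assumption | exact symm _ _ (by assumption)

theorem IsSimpleQuad.card [DecidableEq α] {a b c d : α} (H : IsSimpleQuad g h a b c d) :
    ({a, b, c, d} : Finset α).card = 4 := by
  unfold IsSimpleQuad at H
  have : a ≠ b ∧ a ≠ c ∧ a ≠ d ∧ b ≠ c ∧ b ≠ d ∧ c ≠ d := by
    refine ⟨?_, ?_, ?_, ?_, ?_, ?_⟩ <;> rintro rfl <;> omega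
  obtain ⟨hab, hac, had, hbc, hbd, hcd⟩ := this
  simp [hab, hac, had, hbc, hbd, hcd]

/-- Swapping a point `u` for a point `y` that forms a bond with it preserves bond-freeness. -/
theorem LinFree.insert_erase [DecidableEq α] (hg : g.Injective) (hh : h.Injective)
    {Q : Finset α} (hQ : LinFree g h Q) {u y : α} (hu : u ∈ Q) (hy : y ∉ Q)
    (hgs : ¬ LinSep g Q y u) (hhs : ¬ LinSep h Q y u) :
    LinFree g h (insert y (Q.erase u)) := by
  have key : ∀ f : α → ℤ, f.Injective → ¬ LinSep f Q y u →
      (∀ a ∈ Q, a ≠ u → LinSep f Q u a → LinSep f (insert y (Q.erase u)) y a) ∧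
      ∀ a ∈ Q, a ≠ u → ∀ b ∈ Q, b ≠ u → LinSep f Q a b →
        LinSep f (insert y (Q.erase u)) a b := by
    intro f hf hn
    have hn' : ∀ z ∈ Q, ¬ ((f y < f z ∧ f z < f u) ∨ (f u < f z ∧ f z < f y)) :=
      fun z hz H => hn ⟨z, hz, H⟩
    have hyf : ∀ z ∈ Q, f z ≠ f y := fun z hz H => hy (hf H ▸ hz)
    have huf : ∀ z ∈ Q, z ≠ u → f z ≠ f u := fun z _ hzu H => hzu (hf H)
    refine ⟨?_, ?_⟩
    · rintro a ha hau ⟨z, hz, H⟩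
      have hzu : z ≠ u := by rintro rfl; omega
      refine ⟨z, by simp [hz, hzu], ?_⟩
      have := hn' z hz
      have := hn' a ha
      have := hyf z hz
      have := hyf a ha
      omega
    · rintro a ha hau b hb hbu ⟨z, hz, H⟩
      by_cases hzu : z = u
      · subst hzu
        refine ⟨y, by simp, ?_⟩
        have := hn' a ha
        have := hn' b hb
        have := hyf a ha
        have := hyf b hb
        omega
      · exact ⟨z, by simp [hz, hzu], H⟩
  intro a ha b hb hab
  rw [Finset.mem_insert, Finset.mem_erase] at ha hb
  rcases ha with rfl | ⟨hau, ha⟩ <;> rcases hb with rfl | ⟨hbu, hb⟩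
  · exact absurd rfl hab
  · exact (hQ u hu b hb hbu.symm).imp ((key g hg hgs).1 b hb hbu) ((key h hh hhs).1 b hb hbu)
  · exact (hQ u hu a ha hau.symm).imp (fun H => ((key g hg hgs).1 a ha hau H).symm)
      fun H => ((key h hh hhs).1 a ha hau H).symm
  · exact (hQ a ha b hb hab).imp ((key g hg hgs).2 a ha hau b hb hbu)
      ((key h hh hhs).2 a ha hau b hb hbu)

/-- In a bond-free set every point lies in a bond-free subset of size at most `5`. -/
theorem LinFree.exists_small [DecidableEq α] (hg : g.Injective) (hh : h.Injective)
    {S : Finset α} (hS : LinFree g h S) (hS2 : 2 ≤ S.card) {y : α} (hy : y ∈ S) :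
    ∃ P ⊆ S, y ∈ P ∧ 2 ≤ P.card ∧ P.card ≤ 5 ∧ LinFree g h P := by
  obtain ⟨a, ha, b, hb, c, hc, d, hd, H⟩ := hS.exists_isSimpleQuad hg hh hS2
  have hQS : ({a, b, c, d} : Finset α) ⊆ S := by
    simp [Finset.insert_subset_iff, ha, hb, hc, hd]
  have hQ := H.linFree
  have hcard := H.card
  generalize ({a, b, c, d} : Finset α) = Q at hQS hQ hcard
  by_cases hyQ : y ∈ Q
  · exact ⟨Q, hQS, hyQ, by omega, by omega, hQ⟩
  by_cases hins : ∀ u ∈ Q, LinSep g Q y u ∨ LinSep h Q y u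
  · refine ⟨insert y Q, Finset.insert_subset hy hQS, Finset.mem_insert_self _ _, ?_, ?_, ?_⟩
    · rw [Finset.card_insert_of_notMem hyQ]; omega
    · rw [Finset.card_insert_of_notMem hyQ]; omega
    · have hsub := Finset.subset_insert y Q
      intro u hu v hv huv
      rw [Finset.mem_insert] at hu hv
      rcases hu with rfl | hu <;> rcases hv with rfl | hv
      · exact absurd rfl huv
      · exact (hins v hv).imp (LinSep.mono hsub) (LinSep.mono hsub)
      · exact (hins u hu).imp (fun H => (H.mono hsub).symm) fun H => (H.mono hsub).symm
      · exact (hQ u hu v hv huv).imp (LinSep.mono hsub) (LinSep.mono hsub)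
  · push Not at hins
    obtain ⟨u, hu, hgs, hhs⟩ := hins
    have hcard' : (insert y (Q.erase u)).card = 4 := by
      rw [Finset.card_insert_of_notMem (by simp [hyQ]), Finset.card_erase_of_mem hu]
      omega
    exact ⟨insert y (Q.erase u), Finset.insert_subset hy ((Finset.erase_subset _ _).trans hQS),
      Finset.mem_insert_self _ _, by omega, by omega, hQ.insert_erase hg hh hu hyQ hgs hhs⟩

end Separable

section Cylindrical

variable {α : Type*} {g h : α → ℤ} {s T : Finset α} {x y z a b : α}

theorem Cyc.trichotomy {a b x z : ℤ} (H : Cyc a z b) (ha : x ≠ a) (hb : x ≠ b) :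
    Cyc a x b ∨ Cyc b x a := by
  simp only [Cyc] at *; omega

theorem Cyc.split {a b x z : ℤ} (Hz : Cyc a z b) (hzx : z ≠ x) :
    Cyc a z x ∨ Cyc x z b := by
  simp only [Cyc] at *; omega

theorem Cyc.enlarge_left {a b x w : ℤ} (Hw : Cyc b w a) (Hx : Cyc a x b) : Cyc x w a := by
  simp only [Cyc] at *; omega

theorem Cyc.enlarge_right {a b x w : ℤ} (Hw : Cyc b w a) (Hx : Cyc a x b) : Cyc b w x := by
  simp only [Cyc] at *; omega

theorem CycSep.symm {f : α → ℤ} (H : CycSep f T x y) : CycSep f T y x :=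
  And.symm H

theorem CycSep.mono {f : α → ℤ} (hsT : s ⊆ T) (H : CycSep f s x y) : CycSep f T x y := by
  obtain ⟨⟨z, hz, Hz⟩, w, hw, Hw⟩ := H
  exact ⟨⟨z, hsT hz, Hz⟩, w, hsT hw, Hw⟩

theorem CycSep.of_neg {f : α → ℤ} (H : CycSep (fun x => -f x) T x y) : CycSep f T x y := by
  obtain ⟨⟨z, hz, Hz⟩, w, hw, Hw⟩ := H
  refine ⟨⟨w, hw, ?_⟩, z, hz, ?_⟩
  · simp only [Cyc] at *; omega
  · simp only [Cyc] at *; omega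

theorem LinSep.trans {f : α → ℤ} (hf : f.Injective) (H : LinSep f s a b) (hx : x ∉ s) :
    LinSep f s a x ∨ LinSep f s x b := by
  obtain ⟨z, hz, H⟩ := H
  have hzx : f z ≠ f x := fun hzx => hx (hf hzx ▸ hz)
  have : ((f a < f z ∧ f z < f x) ∨ (f x < f z ∧ f z < f a)) ∨
      ((f x < f z ∧ f z < f b) ∨ (f b < f z ∧ f z < f x)) := by omega
  exact this.imp (fun H => ⟨z, hz, H⟩) fun H => ⟨z, hz, H⟩

theorem CycSep.trans {f : α → ℤ} (hf : f.Injective) (H : CycSep f s a b) (hx : x ∉ s) :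
    CycSep f s a x ∨ CycSep f s x b := by
  obtain ⟨⟨z, hz, Hz⟩, w, hw, Hw⟩ := H
  have hzx : f z ≠ f x := fun hzx => hx (hf hzx ▸ hz)
  have hwx : f w ≠ f x := fun hwx => hx (hf hwx ▸ hw)
  by_cases hax : f x = f a
  · exact Or.inr ⟨⟨z, hz, hax ▸ Hz⟩, w, hw, hax ▸ Hw⟩
  by_cases hbx : f x = f b
  · exact Or.inl ⟨⟨z, hz, hbx ▸ Hz⟩, w, hw, hbx ▸ Hw⟩
  rcases Cyc.trichotomy Hz hax hbx with H | H
  · rcases Hz.split hzx with Hzx | Hzx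
    · exact Or.inl ⟨⟨z, hz, Hzx⟩, w, hw, Hw.enlarge_left H⟩
    · exact Or.inr ⟨⟨z, hz, Hzx⟩, w, hw, Hw.enlarge_right H⟩
  · rcases Hw.split hwx with Hwx | Hwx
    · exact Or.inr ⟨⟨z, hz, Hz.enlarge_left H⟩, w, hw, Hwx⟩
    · exact Or.inl ⟨⟨z, hz, Hz.enlarge_right H⟩, w, hw, Hwx⟩

/-- `x` and `y` are separated by `T` in one of the two orders. -/
def CylSep (g h : α → ℤ) (T : Finset α) (x y : α) : Prop :=
  CycSep g T x y ∨ LinSep h T x y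

theorem CylSep.symm (H : CylSep g h T x y) : CylSep g h T y x :=
  H.imp CycSep.symm LinSep.symm

theorem CylSep.mono (hsT : s ⊆ T) (H : CylSep g h s x y) : CylSep g h T x y :=
  H.imp (CycSep.mono hsT) (LinSep.mono hsT)

theorem CylSep.trans (hg : g.Injective) (hh : h.Injective) (H : CylSep g h s a b) (hx : x ∉ s) :
    CylSep g h s a x ∨ CylSep g h s x b := by
  rcases H with H | H
  · exact (H.trans hg hx).imp Or.inl Or.inl
  · exact (H.trans hh hx).imp Or.inr Or.inr

/-- A point outside a bond-free set has a bond with at most one point of it. -/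
theorem CylFree.cylSep_of_not_cylSep (hg : g.Injective) (hh : h.Injective) (hs : CylFree g h s)
    (hx : x ∉ s) (hy : y ∈ s) (hxy : ¬ CylSep g h s x y) {u : α} (hu : u ∈ s) (huy : u ≠ y) :
    CylSep g h s x u :=
  ((CylSep.trans hg hh (hs y hy u hu huy.symm) hx).resolve_left fun H => hxy H.symm)

theorem CylFree.exists_not_cylSep [DecidableEq α] (hs : CylFree g h s)
    (hins : ¬ CylFree g h (insert x s)) : ∃ y ∈ s, ¬ CylSep g h s x y := by
  by_contra! hcon
  refine hins fun a ha b hb hab => ?_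
  have hsub := Finset.subset_insert x s
  rw [Finset.mem_insert] at ha hb
  rcases ha with rfl | ha <;> rcases hb with rfl | hb
  · exact absurd rfl hab
  · exact (hcon b hb).mono hsub
  · exact (hcon a ha).symm.mono hsub
  · exact CylSep.mono hsub (hs a ha b hb hab)

/-- Two outside points with bonds to different points of a bond-free set can be added together
if they break each other's bonds. -/
theorem CylFree.insert_insert [DecidableEq α] (hg : g.Injective) (hh : h.Injective)
    (hs : CylFree g h s) {y' : α} (hx : x ∉ s) (hz : z ∉ s) (hy : y ∈ s) (hy' : y' ∈ s)
    (hxy : ¬ CylSep g h s x y) (hzy' : ¬ CylSep g h s z y')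
    (hxy' : CylSep g h (insert x (insert z s)) x y)
    (hzy'' : CylSep g h (insert x (insert z s)) z y')
    (hxz : CylSep g h s x z) : CylFree g h (insert x (insert z s)) := by
  have hsub : s ⊆ insert x (insert z s) :=
    (Finset.subset_insert _ _).trans (Finset.subset_insert _ _)
  have hxu : ∀ u ∈ s, CylSep g h (insert x (insert z s)) x u := fun u hu => by
    by_cases huy : u = y
    · exact huy ▸ hxy'
    · exact (hs.cylSep_of_not_cylSep hg hh hx hy hxy hu huy).mono hsub
  have hzu : ∀ u ∈ s, CylSep g h (insert x (insert z s)) z u := fun u hu => by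
    by_cases huy : u = y'
    · exact huy ▸ hzy''
    · exact (hs.cylSep_of_not_cylSep hg hh hz hy' hzy' hu huy).mono hsub
  intro a ha b hb hab
  rw [Finset.mem_insert, Finset.mem_insert] at ha hb
  rcases ha with rfl | rfl | ha <;> rcases hb with rfl | rfl | hb
  · exact absurd rfl hab
  · exact hxz.mono hsub
  · exact hxu b hb
  · exact hxz.symm.mono hsub
  · exact absurd rfl hab
  · exact hzu b hb
  · exact (hxu a ha).symm
  · exact (hzu a ha).symm
  · exact CylSep.mono hsub (hs a ha b hb hab)

/-- If `z` lies on an arc from `x` to `y` that avoids `s`, then `z` separates `x` from `y`, and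
`x` and `y` separate `z` from any other point of `s`. -/
theorem cycSep_of_arc {f : α → ℤ} (hf : f.Injective) {y' : α} (hx : x ∉ s) (hz : z ∉ s)
    (hy : y ∈ s) (hy' : y' ∈ s) (hyy' : y' ≠ y) (hxzy : Cyc (f x) (f z) (f y))
    (hfree : ∀ w ∈ s, ¬ Cyc (f x) (f w) (f y))
    (hsT : s ⊆ T) (hxT : x ∈ T) (hzT : z ∈ T) :
    CycSep f T x y ∧ CycSep f T z y' ∧ ¬ CycSep f s z y := by
  have hy'x : f y' ≠ f x := fun H => hx (hf H ▸ hy')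
  have hy'z : f y' ≠ f z := fun H => hz (hf H ▸ hy')
  have hy'y : f y' ≠ f y := fun H => hyy' (hf H)
  have hy'f := hfree y' hy'
  refine ⟨⟨⟨z, hzT, hxzy⟩, y', hsT hy', ?_⟩, ⟨⟨y, hsT hy, ?_⟩, x, hxT, ?_⟩, ?_⟩
  · simp only [Cyc] at *; omega
  · simp only [Cyc] at *; omega
  · simp only [Cyc] at *; omega
  · rintro ⟨⟨w, hw, Hw⟩, -⟩
    have := hfree w hw
    simp only [Cyc] at *; omega

/-- Cutting the cycle just before a given point `e`. -/
theorem exists_cut [Finite α] (hg : g.Injective) (e : α) :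
    ∃ g' : α → ℤ, g'.Injective ∧ (∀ x, x ≠ e → g' e < g' x) ∧
      ∀ a b c, Cyc (g a) (g b) (g c) ↔ Cyc (g' a) (g' b) (g' c) := by
  obtain ⟨M, hM⟩ := (Set.finite_range g).bddAbove
  obtain ⟨m, hm⟩ := (Set.finite_range g).bddBelow
  have hM' : ∀ x, g x ≤ M := fun x => hM ⟨x, rfl⟩
  have hm' : ∀ x, m ≤ g x := fun x => hm ⟨x, rfl⟩
  refine ⟨fun x => if g x < g e then g x + (M - m + 1) else g x, fun x y hxy => hg ?_,
    fun x hx => ?_, fun a b c => ?_⟩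
  · have := hM' x; have := hm' x; have := hM' y; have := hm' y
    dsimp only at hxy
    split_ifs at hxy <;> omega
  · have : g x ≠ g e := fun H => hx (hg H)
    have := hM' e; have := hm' x
    simp only [lt_irrefl, if_false]
    split_ifs <;> omega
  · have := hM' a; have := hm' a; have := hM' b; have := hm' b; have := hM' c; have := hm' c
    simp only [Cyc]
    split_ifs <;> omega

theorem LinSep.cycSep {f : α → ℤ} {e : α} (he : ∀ x, x ≠ e → f e < f x) (heT : e ∈ T)
    (ha : a ≠ e) (hb : b ≠ e) (H : LinSep f T a b) : CycSep f T a b := by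
  obtain ⟨z, hz, H⟩ := H
  have := he a ha
  have := he b hb
  rcases H with H | H
  · exact ⟨⟨z, hz, by simp only [Cyc]; omega⟩, e, heT, by simp only [Cyc]; omega⟩
  · exact ⟨⟨e, heT, by simp only [Cyc]; omega⟩, z, hz, by simp only [Cyc]; omega⟩

theorem CycSep.linSep {f : α → ℤ} (hf : f.Injective) (hab : a ≠ b) (H : CycSep f T a b) :
    LinSep f T a b := by
  have hne : f a ≠ f b := fun H => hab (hf H)
  obtain ⟨⟨z, hz, Hz⟩, w, hw, Hw⟩ := H
  rcases lt_or_gt_of_ne hne with hlt | hlt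
  · exact ⟨z, hz, by simp only [Cyc] at *; omega⟩
  · exact ⟨w, hw, by simp only [Cyc] at *; omega⟩

/-- A bond-free set properly contained in a bond-free set `univ` can be enlarged to a bond-free
set by adding at most four points. -/
theorem CylFree.exists_ssuperset [Fintype α] [DecidableEq α] (hg : g.Injective)
    (hh : h.Injective) (huniv : CylFree g h univ) (hs : CylFree g h s) (hs2 : 2 ≤ s.card)
    (hne : s ≠ univ) : ∃ T, s ⊂ T ∧ T.card ≤ s.card + 4 ∧ CylFree g h T := by
  by_contra! hcon
  have hbond : ∀ x ∉ s, ∃ y ∈ s, ¬ CylSep g h s x y := fun x hx =>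
    hs.exists_not_cylSep (hcon _ (Finset.ssubset_insert hx) (by
      rw [Finset.card_insert_of_notMem hx]; omega))
  have hpair : ∀ x ∉ s, ∀ z ∉ s, ∀ y ∈ s, ∀ y' ∈ s, ¬ CylSep g h s x y → ¬ CylSep g h s z y' →
      CylSep g h s x z → CylSep g h (insert x (insert z s)) x y →
      ¬ CylSep g h (insert x (insert z s)) z y' := by
    intro x hx z hz y hy y' hy' hxy hzy' hxz hxyT hzyT
    refine hcon _ ((Finset.ssubset_insert hz).trans_subset (Finset.subset_insert _ _)) ?_
      (hs.insert_insert hg hh hx hz hy hy' hxy hzy' hxyT hzyT hxz)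
    have := Finset.card_insert_le x (insert z s)
    have := Finset.card_insert_le z s
    omega
  have hsub : ∀ x z, s ⊆ insert x (insert z s) := fun x z =>
    (Finset.subset_insert _ _).trans (Finset.subset_insert _ _)
  have hLin : ∀ x ∉ s, ∀ y ∈ s, ¬ CylSep g h s x y → ∀ z ∉ s,
      ((h x < h z ∧ h z < h y) ∨ (h y < h z ∧ h z < h x)) → ¬ CylSep g h s z y := by
    intro x hx y hy hxy z hz hbet hzy
    obtain ⟨y', hy', hzy'⟩ := hbond z hz
    have hyy' : y' ≠ y := by rintro rfl; exact hzy' hzy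
    have hxfree : ∀ w ∈ s, ¬ ((h x < h w ∧ h w < h y) ∨ (h y < h w ∧ h w < h x)) :=
      fun w hw H => hxy (Or.inr ⟨w, hw, H⟩)
    have hcyc : CycSep g s z y := hzy.resolve_right fun ⟨w, hw, H⟩ => hxfree w hw (by omega)
    have hzx : CycSep g s z x :=
      (hcyc.trans hg hx).resolve_right fun H => hxy (Or.inl H)
    refine hpair x hx z hz y hy y' hy' hxy hzy' (Or.inl hzx.symm)
      (Or.inr ⟨z, by simp, hbet⟩) (Or.inr ⟨x, by simp, ?_⟩)
    have h1 := hxfree y' hy'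
    have h2 : ¬ ((h z < h y ∧ h y < h y') ∨ (h y' < h y ∧ h y < h z)) :=
      fun H => hzy' (Or.inr ⟨y, hy, H⟩)
    have h3 : h y' ≠ h y := fun H => hyy' (hh H)
    have h4 : h y' ≠ h x := fun H => hx (hh H ▸ hy')
    omega
  have hCyc : ∀ f : α → ℤ, f.Injective → (∀ T a b, CycSep f T a b → CycSep g T a b) →
      (∀ a b, CycSep g s a b → CycSep f s a b) →
      ∀ x ∉ s, ∀ y ∈ s, ¬ CylSep g h s x y → ∀ z ∉ s, Cyc (f x) (f z) (f y) →
      (∀ w ∈ s, ¬ Cyc (f x) (f w) (f y)) → ¬ CylSep g h s z y := by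
    intro f hf hfg hgf x hx y hy hxy z hz hbet hfree hzy
    obtain ⟨y', hy', hzy'⟩ := hbond z hz
    have hyy' : y' ≠ y := by rintro rfl; exact hzy' hzy
    obtain ⟨h1, h2, h3⟩ := cycSep_of_arc hf hx hz hy hy' hyy' hbet hfree (hsub x z)
      (Finset.mem_insert_self _ _) (Finset.mem_insert_of_mem (Finset.mem_insert_self _ _))
    have hlin : LinSep h s z y := hzy.resolve_left fun H => h3 (hgf _ _ H)
    have hzx : LinSep h s z x := (hlin.trans hh hx).resolve_right fun H => hxy (Or.inr H)
    exact hpair x hx z hz y hy y' hy' hxy hzy' (Or.inr hzx.symm) (Or.inl (hfg _ _ _ h1))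
      (Or.inl (hfg _ _ _ h2))
  obtain ⟨x₀, hx₀⟩ : ∃ x, x ∉ s := by
    by_contra! hall
    exact hne (Finset.eq_univ_iff_forall.2 hall)
  obtain ⟨y, hy, hx₀y⟩ := hbond x₀ hx₀
  obtain ⟨e, he, hey⟩ := Finset.exists_mem_ne hs2 y
  obtain ⟨g', hg', he', hcut⟩ := exists_cut hg e
  have hcut' : ∀ T a b, CycSep g T a b ↔ CycSep g' T a b := fun T a b => by
    simp only [CycSep, hcut]
  classical
  set B : Finset α := univ.filter fun x => x = y ∨ (x ∉ s ∧ ¬ CylSep g h s x y) with hB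
  have hBmem : ∀ x, x ∈ B ↔ x = y ∨ (x ∉ s ∧ ¬ CylSep g h s x y) := fun x => by simp [hB]
  have hBe : ∀ x ∈ B, x ≠ e := by
    rintro x hx rfl
    rcases (hBmem _).1 hx with rfl | hx
    · exact hey rfl
    · exact hx.1 he
  have hBlin : ∀ x ∈ B, x ≠ y → ¬ LinSep g' s x y := by
    intro x hx hxy H
    have := ((hBmem x).1 hx).resolve_left hxy
    exact this.2 (Or.inl ((hcut' _ _ _).2 (H.cycSep he' he (hBe x hx) hey.symm)))
  have hbetw : ∀ f : α → ℤ, f.Injective → (∀ x ∈ B, x ≠ y → ¬ LinSep f s x y) →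
      (∀ x ∈ B, x ≠ y → ∀ z ∉ s, ((f x < f z ∧ f z < f y) ∨ (f y < f z ∧ f z < f x)) → z ∈ B) →
      ∀ a ∈ B, ∀ b ∈ B, LinSep f univ a b → LinSep f B a b := by
    rintro f hf hn hcl a ha b hb ⟨z, -, H⟩
    refine ⟨z, ?_, H⟩
    by_cases hzy : z = y
    · exact (hBmem z).2 (Or.inl hzy)
    have hzy' : f z ≠ f y := fun H => hzy (hf H)
    have : ((f a < f z ∧ f z < f y) ∨ (f y < f z ∧ f z < f a)) ∨
      ((f b < f z ∧ f z < f y) ∨ (f y < f z ∧ f z < f b)) := by omega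
    have key : ∀ c ∈ B, ((f c < f z ∧ f z < f y) ∨ (f y < f z ∧ f z < f c)) → z ∈ B := by
      intro c hc H
      have hcy : c ≠ y := by rintro rfl; omega
      exact hcl c hc hcy z (fun hzs => hn c hc hcy ⟨z, hzs, H⟩) H
    exact this.elim (key a ha) (key b hb)
  have hBfree : LinFree g' h B := by
    intro a ha b hb hab
    refine (huniv a (mem_univ _) b (mem_univ _) hab).imp (fun H => ?_) fun H => ?_
    · refine hbetw g' hg' hBlin ?_ a ha b hb (((hcut' _ _ _).1 H).linSep hg' hab)
      intro x hx hxy z hz H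
      have hx' := ((hBmem x).1 hx).resolve_left hxy
      refine (hBmem z).2 (Or.inr ⟨hz, ?_⟩)
      have hfree : ∀ w ∈ s, ¬ ((g' x < g' w ∧ g' w < g' y) ∨ (g' y < g' w ∧ g' w < g' x)) :=
        fun w hw H => hBlin x hx hxy ⟨w, hw, H⟩
      rcases H with H | H
      · refine hCyc g' hg' (fun _ _ _ => (hcut' _ _ _).2) (fun _ _ => (hcut' _ _ _).1)
          x hx'.1 y hy hx'.2 z hz (Or.inl H) fun w hw hw' => ?_
        have := hfree w hw
        simp only [Cyc] at hw'
        omega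
      · refine hCyc (fun x => -g' x) (fun a b hab => hg' (neg_injective hab))
          (fun _ _ _ H => (hcut' _ _ _).2 H.of_neg)
          (fun a b H => CycSep.of_neg (by simpa only [neg_neg] using (hcut' _ _ _).1 H))
          x hx'.1 y hy hx'.2 z hz (Or.inl (by omega)) fun w hw hw' => ?_
        have := hfree w hw
        simp only [Cyc] at hw'
        omega
    · refine hbetw h hh (fun x hx hxy H => ?_) (fun x hx hxy z hz H => ?_) a ha b hb H
      · exact (((hBmem x).1 hx).resolve_left hxy).2 (Or.inr H)
      · have hx' := ((hBmem x).1 hx).resolve_left hxy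
        exact (hBmem z).2 (Or.inr ⟨hz, hLin x hx'.1 y hy hx'.2 z hz H⟩)
  have hyB : y ∈ B := (hBmem y).2 (Or.inl rfl)
  have hx₀B : x₀ ∈ B := (hBmem x₀).2 (Or.inr ⟨hx₀, hx₀y⟩)
  have hB2 : 2 ≤ B.card :=
    Finset.one_lt_card.2 ⟨y, hyB, x₀, hx₀B, fun H => hx₀ (H ▸ hy)⟩
  obtain ⟨P, hPB, hyP, hP2, hP5, hP⟩ := hBfree.exists_small hg' hh hB2 hyB
  have hPs : ∀ x ∈ P, x ≠ y → x ∉ s ∧ ¬ CylSep g h s x y := fun x hx hxy =>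
    ((hBmem x).1 (hPB hx)).resolve_left hxy
  obtain ⟨x, hxP, hxy⟩ := Finset.exists_mem_ne hP2 y
  refine hcon (s ∪ P) (Finset.ssubset_iff_subset_ne.2 ⟨Finset.subset_union_left, fun H => ?_⟩) ?_ ?_
  · exact (hPs x hxP hxy).1 (H ▸ Finset.mem_union_right _ hxP)
  · have hunion : s ∪ P = s ∪ P.erase y := by
      ext w
      simp only [Finset.mem_union, Finset.mem_erase]
      by_cases hw : w = y <;> simp [hw, hy]
    have := Finset.card_union_le s (P.erase y)
    rw [Finset.card_erase_of_mem hyP] at this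
    rw [hunion]
    omega
  · have hPP : ∀ a ∈ P, ∀ b ∈ P, a ≠ b → CylSep g h (s ∪ P) a b := fun a ha b hb hab =>
      (hP a ha b hb hab).imp
        (fun H => (hcut' _ _ _).2 ((H.mono Finset.subset_union_right).cycSep he'
          (Finset.mem_union_left _ he) (hBe a (hPB ha)) (hBe b (hPB hb))))
        (LinSep.mono Finset.subset_union_right)
    have hPS : ∀ a ∈ P, ∀ b ∈ s, a ≠ b → CylSep g h (s ∪ P) a b := by
      intro a ha b hb hab
      by_cases hby : b = y
      · exact hPP a ha b (hby ▸ hyP) hab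
      by_cases hay : a = y
      · subst hay
        exact CylSep.mono Finset.subset_union_left (hs a hy b hb hab)
      · exact (hs.cylSep_of_not_cylSep hg hh (hPs a ha hay).1 hy (hPs a ha hay).2 hb hby).mono
          Finset.subset_union_left
    intro a ha b hb hab
    rw [Finset.mem_union] at ha hb
    rcases ha with ha | ha <;> rcases hb with hb | hb
    · exact CylSep.mono Finset.subset_union_left (hs a ha b hb hab)
    · exact (hPS b hb a ha hab.symm).symm
    · exact hPS a ha b hb hab
    · exact hPP a ha b hb hab

/-- A bond-free set of at least three points contains a bond-free set of exactly five points. -/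
theorem CylFree.exists_card_eq_five [Fintype α] [DecidableEq α] (hg : g.Injective)
    (hh : h.Injective) (huniv : CylFree g h univ) (hcard : 3 ≤ Fintype.card α) :
    ∃ T : Finset α, T.card = 5 ∧ CylFree g h T := by
  have hne : (univ : Finset α).Nonempty := by
    rw [← Finset.card_pos, Finset.card_univ]
    omega
  obtain ⟨e, -, he⟩ := Finset.exists_min_image univ h hne
  have he : ∀ x, x ≠ e → h e < h x := fun x hx =>
    lt_of_le_of_ne (he x (mem_univ _)) fun H => hx (hh H).symm
  obtain ⟨g', hg', he', hcut⟩ := exists_cut hg e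
  have hcut' : ∀ T a b, CycSep g T a b ↔ CycSep g' T a b := fun T a b => by
    simp only [CycSep, hcut]
  have hfree : LinFree g' h (univ.erase e) := by
    intro a ha b hb hab
    have hae := Finset.ne_of_mem_erase ha
    have hbe := Finset.ne_of_mem_erase hb
    have h1 := he a hae
    have h2 := he b hbe
    have h3 := he' a hae
    have h4 := he' b hbe
    refine (huniv a (mem_univ _) b (mem_univ _) hab).imp (fun H => ?_) fun H => ?_
    · obtain ⟨z, -, H⟩ := ((hcut' _ _ _).1 H).linSep hg' hab
      refine ⟨z, Finset.mem_erase.2 ⟨?_, mem_univ _⟩, H⟩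
      rintro rfl
      omega
    · obtain ⟨z, -, H⟩ := H
      refine ⟨z, Finset.mem_erase.2 ⟨?_, mem_univ _⟩, H⟩
      rintro rfl
      omega
  have herase : 2 ≤ (univ.erase e).card := by
    rw [Finset.card_erase_of_mem (mem_univ _), Finset.card_univ]
    omega
  obtain ⟨a, ha, b, hb, c, hc, d, hd, H⟩ := hfree.exists_isSimpleQuad hg' hh herase
  have hQ := H.linFree
  have hQc := H.card
  have hae := Finset.ne_of_mem_erase ha
  have hbe := Finset.ne_of_mem_erase hb
  have hce := Finset.ne_of_mem_erase hc
  have hde := Finset.ne_of_mem_erase hd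
  have heQ : e ∉ ({a, b, c, d} : Finset α) := by
    simp [hae.symm, hbe.symm, hce.symm, hde.symm]
  refine ⟨insert e {a, b, c, d}, by rw [Finset.card_insert_of_notMem heQ, hQc], ?_⟩
  have h_ea := he a hae
  have h_ed := he d hde
  have h_eb' := he' b hbe
  have h_ea' := he' a hae
  obtain ⟨hab, hbc, hcd, H⟩ := H
  have hins : ∀ x ∈ ({a, b, c, d} : Finset α), CylSep g h (insert e {a, b, c, d}) e x := by
    intro x hx
    simp only [Finset.mem_insert, Finset.mem_singleton] at hx
    have h_eb := he b hbe
    have h_ec := he c hce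
    rcases hx with rfl | rfl | rfl | rfl
    · rcases H with H | H
      · exact Or.inr ⟨b, by simp, by omega⟩
      · exact Or.inr ⟨c, by simp, by omega⟩
    · exact Or.inl ((hcut' _ _ _).2
        ⟨⟨a, by simp, by simp only [Cyc]; omega⟩, c, by simp, by simp only [Cyc]; omega⟩)
    · exact Or.inl ((hcut' _ _ _).2
        ⟨⟨a, by simp, by simp only [Cyc]; omega⟩, d, by simp, by simp only [Cyc]; omega⟩)
    · rcases H with H | H
      · exact Or.inr ⟨b, by simp, by omega⟩
      · exact Or.inr ⟨c, by simp, by omega⟩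
  intro x hx y hy hxy
  rw [Finset.mem_insert] at hx hy
  rcases hx with rfl | hx <;> rcases hy with rfl | hy
  · exact absurd rfl hxy
  · exact hins y hy
  · exact (hins x hx).symm
  · exact (hQ x hx y hy hxy).imp
      (fun H => (hcut' _ _ _).2 ((H.mono (Finset.subset_insert _ _)).cycSep he'
        (Finset.mem_insert_self _ _) (fun H => heQ (H ▸ hx)) fun H => heQ (H ▸ hy)))
      (LinSep.mono (Finset.subset_insert _ _))

/-- A proper bond-free subset of at least two points extends to a proper bond-free subset that
misses at most four points. -/
theorem CylFree.exists_maximal [Fintype α] [DecidableEq α] (hg : g.Injective)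
    (hh : h.Injective) (huniv : CylFree g h univ) (hs : CylFree g h s) (hs2 : 2 ≤ s.card)
    (hne : s ≠ univ) :
    ∃ T, s ⊆ T ∧ CylFree g h T ∧ T ≠ univ ∧ Fintype.card α ≤ T.card + 4 := by
  classical
  have hmem : s ∈ univ.filter fun T : Finset α => s ⊆ T ∧ CylFree g h T ∧ T ≠ univ := by
    simp [hs, hne]
  obtain ⟨T, hT, hmax⟩ := Finset.exists_max_image _ Finset.card ⟨s, hmem⟩
  obtain ⟨-, hsT, hTfree, hTne⟩ := Finset.mem_filter.1 hT
  obtain ⟨T', hTT', hcard, hT'⟩ :=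
    huniv.exists_ssuperset hg hh hTfree (hs2.trans (Finset.card_le_card hsT)) hTne
  refine ⟨T, hsT, hTfree, hTne, ?_⟩
  by_cases hT'univ : T' = univ
  · rwa [hT'univ, Finset.card_univ] at hcard
  · have := hmax T' (by simp [hsT.trans hTT'.1, hT', hT'univ])
    exact absurd (Finset.card_lt_card hTT') (by omega)

end Cylindrical

section Patterns

variable {n m : ℕ} {σ : Equiv.Perm (Fin n)} {π : Equiv.Perm (Fin m)}

theorem posInt_injective (n : ℕ) : (fun i : Fin n => ((i : ℕ) : ℤ)).Injective :=
  fun i j hij => Fin.ext (by simpa using hij)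

theorem valInt_injective (σ : Equiv.Perm (Fin n)) :
    (fun i : Fin n => ((σ i : ℕ) : ℤ)).Injective :=
  (posInt_injective n).comp σ.injective

/-- No two points of the plot of `σ` over `T` form a cylindrical bond within `T`. -/
def PermFree (σ : Equiv.Perm (Fin n)) (T : Finset (Fin n)) : Prop :=
  CylFree (fun i : Fin n => ((i : ℕ) : ℤ)) (fun i => ((σ i : ℕ) : ℤ)) T

/-- The cyclic interval from `i` to `j` is nonempty unless `j` is the successor of `i`. -/
theorem exists_cyc_of_ne_succ {i j : Fin n} (hij : i ≠ j) (hne : (j : ℕ) ≠ ((i : ℕ) + 1) % n) :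
    ∃ z : Fin n, Cyc (i : ℕ) (z : ℕ) (j : ℕ) := by
  have hij' : (i : ℕ) ≠ j := fun H => hij (Fin.ext H)
  have hi := i.2
  have hj := j.2
  rcases Nat.lt_or_ge ((i : ℕ) + 1) n with hlt | hge
  · rw [Nat.mod_eq_of_lt hlt] at hne
    exact ⟨⟨i + 1, hlt⟩, by simp only [Cyc]; omega⟩
  · have hin : (i : ℕ) + 1 = n := by omega
    rw [hin, Nat.mod_self] at hne
    exact ⟨⟨0, by omega⟩, by simp only [Cyc]; omega⟩

theorem IsCylKing.permFree (hσ : IsCylKing ⇑σ) : PermFree σ univ := by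
  intro i _ j _ hij
  by_cases hd : 1 < Nat.dist (σ i) (σ j)
  · right
    simp only [Nat.dist] at hd
    have hi := (σ i).2
    have hj := (σ j).2
    refine ⟨σ.symm ⟨min (σ i : ℕ) (σ j : ℕ) + 1, by omega⟩, mem_univ _, ?_⟩
    simp only [Equiv.apply_symm_apply]
    omega
  · left
    obtain ⟨z, hz⟩ := exists_cyc_of_ne_succ hij fun H => hd (hσ i j hij H)
    obtain ⟨w, hw⟩ := exists_cyc_of_ne_succ hij.symm fun H =>
      hd (Nat.dist_comm (σ j : ℕ) (σ i) ▸ hσ j i hij.symm H)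
    exact ⟨⟨z, mem_univ _, hz⟩, w, mem_univ _, hw⟩

theorem PermFree.isCylKing (H : PermFree σ univ) : IsCylKing ⇑σ := by
  intro i j hij hj
  have hi := i.2
  rcases H i (mem_univ _) j (mem_univ _) hij with ⟨⟨z, -, hz⟩, -⟩ | ⟨z, -, hz⟩
  · exfalso
    have := z.2
    rcases Nat.lt_or_ge ((i : ℕ) + 1) n with hlt | hge
    · rw [Nat.mod_eq_of_lt hlt] at hj
      simp only [Cyc] at hz
      omega
    · have hin : (i : ℕ) + 1 = n := by omega
      rw [hin, Nat.mod_self] at hj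
      simp only [Cyc] at hz
      omega
  · simp only [Nat.dist]
    simp only [Nat.cast_lt] at hz
    omega

theorem StrictMono.cyc_iff {f : Fin m → Fin n} (hf : StrictMono f) (a b c : Fin m) :
    Cyc (f a : ℕ) (f b : ℕ) (f c : ℕ) ↔ Cyc (a : ℕ) (b : ℕ) (c : ℕ) := by
  simp only [Cyc, Nat.cast_lt, Fin.val_fin_lt, hf.lt_iff_lt]

theorem permFree_map_iff {f : Fin m ↪ Fin n} (hf : StrictMono f)
    (hp : ∀ a b, (π a < π b ↔ σ (f a) < σ (f b))) :
    PermFree σ (univ.map f) ↔ PermFree π univ := by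
  simp only [PermFree, CylFree, CycSep, LinSep, Finset.mem_map, mem_univ, true_and,
    forall_exists_index, forall_apply_eq_imp_iff, exists_exists_eq_and, hf.cyc_iff, Nat.cast_lt,
    Fin.val_fin_lt, ← hp, ne_eq, f.injective.eq_iff, forall_const]

/-- The pattern formed by the points of a given set. -/
theorem exists_pattern (σ : Equiv.Perm (Fin n)) (T : Finset (Fin n)) :
    ∃ τ : Equiv.Perm (Fin T.card), ∀ a b,
      (τ a < τ b ↔ σ (T.orderEmbOfFin rfl a) < σ (T.orderEmbOfFin rfl b)) := by
  have hcard : (T.map σ.toEmbedding).card = T.card := Finset.card_map _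
  let e := (T.orderIsoOfFin rfl).toEquiv
  let k : T ≃ T.map σ.toEmbedding := σ.subtypeEquiv fun a => by simp
  let o := (T.map σ.toEmbedding).orderIsoOfFin hcard
  refine ⟨(e.trans k).trans o.symm.toEquiv, fun a b => ?_⟩
  simp only [Equiv.trans_apply, RelIso.coe_fn_toEquiv, o.symm.lt_iff_lt]
  rfl

/-- A bond-free set of points gives a cylindrical king pattern. -/
theorem PermFree.exists_isCylKing {T : Finset (Fin n)} (hT : PermFree σ T) :
    ∃ τ : Equiv.Perm (Fin T.card), IsCylKing ⇑τ ∧ ContainsPat ⇑σ ⇑τ ∧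
      ∀ (m : ℕ) (π : Equiv.Perm (Fin m)) (f : Fin m → Fin n), StrictMono f →
        (∀ a b, (π a < π b ↔ σ (f a) < σ (f b))) → (∀ a, f a ∈ T) → ContainsPat ⇑τ ⇑π := by
  obtain ⟨τ, hτ⟩ := exists_pattern σ T
  refine ⟨τ, PermFree.isCylKing ?_, ⟨_, (T.orderEmbOfFin rfl).strictMono, hτ⟩, ?_⟩
  · rw [← permFree_map_iff (f := (T.orderEmbOfFin rfl).toEmbedding)
      (T.orderEmbOfFin rfl).strictMono hτ, Finset.map_orderEmbOfFin_univ]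
    exact hT
  · intro m π f hf hp hfT
    have hk : ∀ a, T.orderEmbOfFin rfl ((T.orderIsoOfFin rfl).symm ⟨f a, hfT a⟩) = f a := by
      intro a
      rw [← Finset.coe_orderIsoOfFin_apply, OrderIso.apply_symm_apply]
    refine ⟨fun a => (T.orderIsoOfFin rfl).symm ⟨f a, hfT a⟩, fun a b hab => ?_, fun a b => ?_⟩
    · exact (T.orderIsoOfFin rfl).symm.strictMono (hf hab)
    · rw [hτ, hk, hk, hp]

/-- A proper bond-free set of at least two points of a cylindrical king permutation extends to a
bond-free set that misses between one and four points. -/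
theorem IsCylKing.exists_pattern_of_subset (hσ : IsCylKing ⇑σ) {s : Finset (Fin n)}
    (hs : PermFree σ s) (hs2 : 2 ≤ s.card) (hne : s.card < n) :
    ∃ T, s ⊆ T ∧ PermFree σ T ∧ T.card < n ∧ n - T.card ≤ 4 := by
  obtain ⟨T, hsT, hT, hTne, hcard⟩ := CylFree.exists_maximal (posInt_injective n)
    (valInt_injective σ) hσ.permFree hs hs2 (by rintro rfl; simp at hne)
  rw [Fintype.card_fin] at hcard
  refine ⟨T, hsT, hT, ?_, by omega⟩
  simpa using Finset.card_lt_univ_of_notMem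
    (Classical.not_forall.1 fun H => hTne (Finset.eq_univ_iff_forall.2 H)).choose_spec

end Patterns

theorem containsPat_of_le_one {l m : ℕ} (τ : Equiv.Perm (Fin l)) (π : Equiv.Perm (Fin m))
    (hm : m ≤ 1) (hl : 0 < l) : ContainsPat ⇑τ ⇑π := by
  have : Subsingleton (Fin m) := Fin.subsingleton_iff_le_one.2 hm
  refine ⟨fun _ => ⟨0, hl⟩, Subsingleton.strictMono _, fun a b => ?_⟩
  rw [Subsingleton.elim a b]
  simp

theorem stmt_17 (n m : ℕ) (σ : Equiv.Perm (Fin n)) (π : Equiv.Perm (Fin m))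
    (hσ : IsCylKing ⇑σ) (hπ : IsCylKing ⇑π) (hc : ContainsPat ⇑σ ⇑π)
    (hgap : 4 < n - m) :
    ∃ (l : ℕ) (τ : Equiv.Perm (Fin l)),
      IsCylKing ⇑τ ∧ ContainsPat ⇑σ ⇑τ ∧ ContainsPat ⇑τ ⇑π ∧
      m < l ∧ l < n ∧ n - l ≤ 4 := by
  rcases Nat.lt_or_ge 1 m with hm | hm
  · obtain ⟨f, hf, hp⟩ := hc
    have hcard : (univ.map ⟨f, hf.injective⟩).card = m := by simp
    obtain ⟨T, hsT, hT, hTn, hT4⟩ := hσ.exists_pattern_of_subset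
      ((permFree_map_iff (f := ⟨f, hf.injective⟩) hf hp).2 hπ.permFree) (by omega) (by omega)
    obtain ⟨τ, hτ, hστ, hτπ⟩ := hT.exists_isCylKing
    exact ⟨T.card, τ, hτ, hστ, hτπ m π f hf hp fun a => hsT (by simp), by omega, hTn, hT4⟩
  rcases Nat.lt_or_ge 5 n with hn | hn
  · obtain ⟨s, hs5, hs⟩ := CylFree.exists_card_eq_five (posInt_injective n)
      (valInt_injective σ) hσ.permFree (by rw [Fintype.card_fin]; omega)
    obtain ⟨T, hsT, hT, hTn, hT4⟩ := hσ.exists_pattern_of_subset hs (by omega) (by omega)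
    have := Finset.card_le_card hsT
    obtain ⟨τ, hτ, hστ, -⟩ := hT.exists_isCylKing
    exact ⟨T.card, τ, hτ, hστ, containsPat_of_le_one τ π hm (by omega), by omega, hTn, hT4⟩
  · refine ⟨1, Equiv.refl _, fun i j hij => absurd (Subsingleton.elim i j) hij,
      containsPat_of_le_one σ _ le_rfl (by omega), containsPat_of_le_one _ π hm one_pos, ?_⟩
    omega
end
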